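/- Assume the Lagrangian L has a saddle point, assume the scaling condition holds, and let (x,λ) be a global solution of the primal-dual dynamical system. Then sup_{t ≥ t₀} ‖β(t)(Ax(t) − b) + ∫_{t₀}^{t} (β(s)/δ − β̇(s))(Ax(s) − b) ds‖ < +∞. -/

import Mathlib

open scoped RealInnerProductSpace
open MeasureTheory Set

noncomputable def Lagr {n m : ℕ} (f : EuclideanSpace ℝ (Fin n) → ℝ)
    (A : EuclideanSpace ℝ (Fin n) →L[ℝ] EuclideanSpace ℝ (Fin m))
    (b : EuclideanSpace ℝ (Fin m))
    (x : EuclideanSpace ℝ (Fin n)) (lam : EuclideanSpace ℝ (Fin m)) : ℝ :=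
  f x + ⟪lam, A x - b⟫

noncomputable def AugLagr {n m : ℕ} (f : EuclideanSpace ℝ (Fin n) → ℝ)
    (A : EuclideanSpace ℝ (Fin n) →L[ℝ] EuclideanSpace ℝ (Fin m))
    (b : EuclideanSpace ℝ (Fin m)) (σ : ℝ)
    (x : EuclideanSpace ℝ (Fin n)) (lam : EuclideanSpace ℝ (Fin m)) : ℝ :=
  Lagr f A b x lam + σ / 2 * ‖A x - b‖ ^ 2

def IsSaddlePoint {n m : ℕ} (f : EuclideanSpace ℝ (Fin n) → ℝ)
    (A : EuclideanSpace ℝ (Fin n) →L[ℝ] EuclideanSpace ℝ (Fin m))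
    (b : EuclideanSpace ℝ (Fin m))
    (xs : EuclideanSpace ℝ (Fin n)) (ls : EuclideanSpace ℝ (Fin m)) : Prop :=
  ∀ x lam, Lagr f A b xs lam ≤ Lagr f A b xs ls ∧ Lagr f A b xs ls ≤ Lagr f A b x ls

theorem ConvexOn.gradient_inner_le_sub {E : Type*} [NormedAddCommGroup E] [InnerProductSpace ℝ E]
    [CompleteSpace E] {f : E → ℝ} (hf : ConvexOn ℝ Set.univ f) {x : E}
    (hx : DifferentiableAt ℝ f x) (y : E) : ⟪gradient f x, y - x⟫ ≤ f y - f x := by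
  have hconv : ConvexOn ℝ Set.univ (f ∘ AffineMap.lineMap (k := ℝ) x y) := by
    simpa using hf.comp_affineMap (AffineMap.lineMap (k := ℝ) x y)
  have hline : HasDerivAt (AffineMap.lineMap (k := ℝ) x y) (y - x) 0 :=
    AffineMap.hasDerivAt_lineMap
  have hgrad : HasFDerivAt f (InnerProductSpace.toDual ℝ E (gradient f x))
      (AffineMap.lineMap (k := ℝ) x y 0) := by
    simpa using hx.hasGradientAt.hasFDerivAt
  have hle := hconv.le_slope_of_hasDerivAt (mem_univ 0) (mem_univ 1) one_pos
    (hgrad.comp_hasDerivAt 0 hline)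
  simpa [slope_def_field] using hle

section SaddlePoint

variable {n m : ℕ} {f : EuclideanSpace ℝ (Fin n) → ℝ}
  {A : EuclideanSpace ℝ (Fin n) →L[ℝ] EuclideanSpace ℝ (Fin m)}
  {b : EuclideanSpace ℝ (Fin m)}
  {xs : EuclideanSpace ℝ (Fin n)} {ls : EuclideanSpace ℝ (Fin m)}

theorem IsSaddlePoint.map_eq (h : IsSaddlePoint f A b xs ls) : A xs = b := by
  have h1 := (h xs (ls + (A xs - b))).1
  simp only [Lagr, inner_add_left] at h1
  have h2 : ⟪A xs - b, A xs - b⟫ ≤ 0 := by linarith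
  exact sub_eq_zero.mp (real_inner_self_nonpos.mp h2)

theorem IsSaddlePoint.le_augLagr (h : IsSaddlePoint f A b xs ls) {σ : ℝ} (hσ : 0 ≤ σ)
    (x : EuclideanSpace ℝ (Fin n)) : f xs ≤ AugLagr f A b σ x ls := by
  have h1 := (h x ls).2
  have h2 : Lagr f A b xs ls = f xs := by simp [Lagr, h.map_eq]
  have h3 : 0 ≤ σ / 2 * ‖A x - b‖ ^ 2 := by positivity
  unfold AugLagr
  linarith

theorem hasDerivWithinAt_augLagr_comp {σ : ℝ} {x : ℝ → EuclideanSpace ℝ (Fin n)}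
    {x' : EuclideanSpace ℝ (Fin n)} {s : Set ℝ} {t : ℝ}
    (hf : DifferentiableAt ℝ f (x t)) (hx : HasDerivWithinAt x x' s t) :
    HasDerivWithinAt (fun τ => AugLagr f A b σ (x τ) ls)
      (⟪gradient f (x t), x'⟫ + ⟪ls, A x'⟫ + σ * ⟪A (x t) - b, A x'⟫) s t := by
  have hfx : HasDerivWithinAt (fun τ => f (x τ)) ⟪gradient f (x t), x'⟫ s t := by
    have hgrad : HasFDerivAt f (InnerProductSpace.toDual ℝ _ (gradient f (x t))) (x t) :=
      hf.hasGradientAt.hasFDerivAt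
    exact hgrad.comp_hasDerivWithinAt t hx
  have hr : HasDerivWithinAt (fun τ => A (x τ) - b) (A x') s t :=
    (A.hasFDerivAt.comp_hasDerivWithinAt t hx).sub_const b
  have hinner : HasDerivWithinAt (fun τ => ⟪ls, A (x τ) - b⟫) ⟪ls, A x'⟫ s t := by
    simpa using (hasDerivWithinAt_const t s ls).inner ℝ hr
  refine ((hfx.add hinner).add (hr.norm_sq.const_mul (σ / 2))).congr_deriv ?_
  ring

/-- A Lyapunov function of the primal-dual dynamics, evaluated at position `x`, velocity `v`,
multiplier `l` and time scaling `β`. -/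
noncomputable def primalDualEnergy (f : EuclideanSpace ℝ (Fin n) → ℝ)
    (A : EuclideanSpace ℝ (Fin n) →L[ℝ] EuclideanSpace ℝ (Fin m))
    (b : EuclideanSpace ℝ (Fin m)) (γ δ σ : ℝ)
    (xs : EuclideanSpace ℝ (Fin n)) (ls : EuclideanSpace ℝ (Fin m))
    (β : ℝ) (x v : EuclideanSpace ℝ (Fin n)) (l : EuclideanSpace ℝ (Fin m)) : ℝ :=
  δ ^ 2 * (β * (AugLagr f A b σ x ls - f xs)) + 1 / 2 * ‖x - xs + δ • v‖ ^ 2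
    + (δ * γ - 1) / 2 * ‖x - xs‖ ^ 2 + δ / 2 * ‖l - ls‖ ^ 2

theorem IsSaddlePoint.norm_sq_le_primalDualEnergy (h : IsSaddlePoint f A b xs ls)
    {γ δ σ β : ℝ} (hσ : 0 ≤ σ) (hβ : 0 ≤ β) (hδγ : 1 ≤ δ * γ)
    (x v : EuclideanSpace ℝ (Fin n)) (l : EuclideanSpace ℝ (Fin m)) :
    δ / 2 * ‖l - ls‖ ^ 2 ≤ primalDualEnergy f A b γ δ σ xs ls β x v l := by
  have h1 : 0 ≤ AugLagr f A b σ x ls - f xs := sub_nonneg.mpr (h.le_augLagr hσ x)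
  have h2 : 0 ≤ δ * γ - 1 := sub_nonneg.mpr hδγ
  unfold primalDualEnergy
  have h3 : 0 ≤ δ ^ 2 * (β * (AugLagr f A b σ x ls - f xs)) + 1 / 2 * ‖x - xs + δ • v‖ ^ 2
    + (δ * γ - 1) / 2 * ‖x - xs‖ ^ 2 := by positivity
  linarith

theorem hasDerivWithinAt_primalDualEnergy (hA : A xs = b) {γ δ σ β' t : ℝ} {s : Set ℝ}
    {β : ℝ → ℝ} {x v : ℝ → EuclideanSpace ℝ (Fin n)} {l : ℝ → EuclideanSpace ℝ (Fin m)}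
    {v' : EuclideanSpace ℝ (Fin n)} {l' : EuclideanSpace ℝ (Fin m)}
    (hf : DifferentiableAt ℝ f (x t)) (hβ : HasDerivWithinAt β β' s t)
    (hx : HasDerivWithinAt x (v t) s t) (hv : HasDerivWithinAt v v' s t)
    (hl : HasDerivWithinAt l l' s t)
    (hode1 : v' + γ • v t =
      -(β t) • (gradient f (x t) + A.adjoint (l t) + σ • A.adjoint (A (x t) - b)))
    (hode2 : l' = β t • (A (x t + δ • v t) - b)) :
    HasDerivWithinAt (fun τ => primalDualEnergy f A b γ δ σ xs ls (β τ) (x τ) (v τ) (l τ))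
      (δ ^ 2 * β' * (AugLagr f A b σ (x t) ls - f xs)
        - δ * β t * (⟪gradient f (x t), x t - xs⟫ + ⟪ls, A (x t) - b⟫ + σ * ‖A (x t) - b‖ ^ 2)
        - δ * (δ * γ - 1) * ‖v t‖ ^ 2) s t := by
  have hu : HasDerivWithinAt (fun τ => x τ - xs) (v t) s t := hx.sub_const xs
  have hF : HasDerivWithinAt (fun τ => AugLagr f A b σ (x τ) ls - f xs) _ s t :=
    (hasDerivWithinAt_augLagr_comp (A := A) (b := b) (ls := ls) (σ := σ) hf hx).sub_const (f xs)
  have hw : HasDerivWithinAt (fun τ => x τ - xs + δ • v τ) (v t + δ • v') s t :=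
    hu.add (hv.const_smul δ)
  refine (((((hβ.mul hF).const_mul (δ ^ 2)).add (hw.norm_sq.const_mul (1 / 2))).add
    (hu.norm_sq.const_mul ((δ * γ - 1) / 2))).add
    ((hl.sub_const ls).norm_sq.const_mul (δ / 2))).congr_deriv ?_
  have hv' : v' = -(β t) • (gradient f (x t) + A.adjoint (l t) + σ • A.adjoint (A (x t) - b))
      - γ • v t := eq_sub_of_add_eq hode1
  have hAu : A (x t) = A (x t - xs) + b := by rw [map_sub, hA]; abel
  have hAw : A (x t + δ • v t) - b = A (x t - xs) + δ • A (v t) := by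
    rw [map_add, map_smul, hAu]; abel
  rw [hode2, hAw, hv', hAu]
  generalize x t - xs = u
  simp only [add_sub_cancel_right, inner_add_left, inner_add_right, inner_sub_left,
    inner_sub_right, inner_smul_left, inner_smul_right, ContinuousLinearMap.adjoint_inner_right,
    map_add, map_smul,
    ← real_inner_self_eq_norm_sq, RCLike.conj_to_real]
  rw [real_inner_comm (gradient f (x t)) u, real_inner_comm (gradient f (x t)) (v t),
    real_inner_comm (l t) (A u), real_inner_comm (l t) (A (v t)),
    real_inner_comm (A u) (A (v t))]
  ring

end SaddlePoint

theorem sup_feasibility_combination_bounded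
    {n m : ℕ}
    (f : EuclideanSpace ℝ (Fin n) → ℝ)
    (hf_conv : ConvexOn ℝ Set.univ f)
    (hf_smooth : ContDiff ℝ 1 f)
    (A : EuclideanSpace ℝ (Fin n) →L[ℝ] EuclideanSpace ℝ (Fin m))
    (b : EuclideanSpace ℝ (Fin m))
    (t₀ γ δ σ : ℝ) (ht₀ : 0 ≤ t₀) (hγ : 0 < γ) (hδ : 0 < δ) (hσ : 0 < σ)
    (β β' : ℝ → ℝ)
    (hβpos : ∀ t ∈ Ici t₀, 0 < β t)
    (hβderiv : ∀ t ∈ Ici t₀, HasDerivWithinAt β (β' t) (Ici t₀) t)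
    (hβ'cont : ContinuousOn β' (Ici t₀))
    (hsaddle : ∃ (xs : EuclideanSpace ℝ (Fin n)) (ls : EuclideanSpace ℝ (Fin m)),
      IsSaddlePoint f A b xs ls)
    (hscale : ∀ t ∈ Ici t₀, β' t ≤ β t / δ) (hscale' : 1 / δ < γ)
    (x x' x'' : ℝ → EuclideanSpace ℝ (Fin n))
    (lam lam' : ℝ → EuclideanSpace ℝ (Fin m))
    (hx : ∀ t ∈ Ici t₀, HasDerivWithinAt x (x' t) (Ici t₀) t)
    (hx' : ∀ t ∈ Ici t₀, HasDerivWithinAt x' (x'' t) (Ici t₀) t)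
    (hx''cont : ContinuousOn x'' (Ici t₀))
    (hlam : ∀ t ∈ Ici t₀, HasDerivWithinAt lam (lam' t) (Ici t₀) t)
    (hlam'cont : ContinuousOn lam' (Ici t₀))
    (hode1 : ∀ t ∈ Ici t₀, x'' t + γ • x' t =
      -(β t) • (gradient f (x t) + A.adjoint (lam t) + σ • A.adjoint (A (x t) - b)))
    (hode2 : ∀ t ∈ Ici t₀, lam' t = β t • (A (x t + δ • x' t) - b))
    :
    ∃ C : ℝ, ∀ t ∈ Ici t₀,
      ‖β t • (A (x t) - b) + ∫ s in t₀..t, (β s / δ - β' s) • (A (x s) - b)‖ ≤ C := by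
  obtain ⟨xs, ls, hs⟩ := hsaddle
  have hA := hs.map_eq
  have hδγ : 1 ≤ δ * γ := by
    rw [div_lt_iff₀ hδ] at hscale'
    linarith
  have hdiff : Differentiable ℝ f := hf_smooth.differentiable one_ne_zero
  have hderiv := fun t ht => hasDerivWithinAt_primalDualEnergy (ls := ls) hA (hdiff (x t))
    (hβderiv t ht) (hx t ht) (hx' t ht) (hlam t ht) (hode1 t ht) (hode2 t ht)
  have hanti : AntitoneOn
      (fun t => primalDualEnergy f A b γ δ σ xs ls (β t) (x t) (x' t) (lam t)) (Ici t₀) := by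
    refine antitoneOn_of_hasDerivWithinAt_nonpos (convex_Ici t₀)
      (fun t ht => (hderiv t ht).continuousWithinAt)
      (fun t ht => (hderiv t (interior_subset ht)).mono interior_subset) fun t ht => ?_
    have ht' : t ∈ Ici t₀ := interior_subset ht
    have hF : 0 ≤ AugLagr f A b σ (x t) ls - f xs := sub_nonneg.mpr (hs.le_augLagr hσ.le (x t))
    have hgrad : AugLagr f A b σ (x t) ls - f xs ≤ ⟪gradient f (x t), x t - xs⟫
        + ⟪ls, A (x t) - b⟫ + σ * ‖A (x t) - b‖ ^ 2 := by
      have h1 := hf_conv.gradient_inner_le_sub (hdiff (x t)) xs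
      rw [← neg_sub (x t) xs, inner_neg_right] at h1
      have h2 : 0 ≤ σ * ‖A (x t) - b‖ ^ 2 := by positivity
      unfold AugLagr Lagr
      linarith
    have h1 := mul_le_mul_of_nonneg_left hgrad (mul_pos hδ (hβpos t ht')).le
    have h2 : δ ^ 2 * β' t ≤ δ * β t := by
      have h := (le_div_iff₀ hδ).mp (hscale t ht')
      nlinarith
    have h3 := mul_le_mul_of_nonneg_right h2 hF
    have h4 : 0 ≤ δ * (δ * γ - 1) * ‖x' t‖ ^ 2 :=
      mul_nonneg (mul_nonneg hδ.le (sub_nonneg.mpr hδγ)) (sq_nonneg _)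
    linarith
  obtain ⟨M, hM⟩ : ∃ M, ∀ t ∈ Ici t₀, ‖lam t - ls‖ ≤ M := by
    refine ⟨√(2 / δ * primalDualEnergy f A b γ δ σ xs ls (β t₀) (x t₀) (x' t₀) (lam t₀)),
      fun t ht => Real.le_sqrt_of_sq_le ?_⟩
    have h1 := (hs.norm_sq_le_primalDualEnergy hσ.le (hβpos t ht).le hδγ (x t) (x' t) (lam t)).trans
      (hanti self_mem_Ici ht ht)
    calc ‖lam t - ls‖ ^ 2 = 2 / δ * (δ / 2 * ‖lam t - ls‖ ^ 2) := by field_simp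
      _ ≤ _ := mul_le_mul_of_nonneg_left h1 (by positivity)
  have hG : ∀ t ∈ Ici t₀, HasDerivWithinAt (fun s => δ⁻¹ • lam s - β s • (A (x s) - b))
      ((β t / δ - β' t) • (A (x t) - b)) (Ici t₀) t := fun t ht => by
    refine (((hlam t ht).const_smul δ⁻¹).sub ((hβderiv t ht).smul
      ((A.hasFDerivAt.comp_hasDerivWithinAt t (hx t ht)).sub_const b))).congr_deriv ?_
    rw [hode2 t ht, map_add, map_smul]
    simp only [Function.comp_apply]
    match_scalars <;> field_simp <;> ring
  have hcont : ContinuousOn (fun s => (β s / δ - β' s) • (A (x s) - b)) (Ici t₀) := by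
    have hβc : ContinuousOn β (Ici t₀) := fun t ht => (hβderiv t ht).continuousWithinAt
    have hxc : ContinuousOn x (Ici t₀) := fun t ht => (hx t ht).continuousWithinAt
    fun_prop
  have hint : ∀ t ∈ Ici t₀, ∫ s in t₀..t, (β s / δ - β' s) • (A (x s) - b) =
      (δ⁻¹ • lam t - β t • (A (x t) - b)) - (δ⁻¹ • lam t₀ - β t₀ • (A (x t₀) - b)) :=
    fun t ht => intervalIntegral.integral_eq_sub_of_hasDerivAt_of_le ht
      (fun s hs => ((hG s hs.1).continuousWithinAt).mono Icc_subset_Ici_self)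
      (fun s hs => (hG s hs.1.le).hasDerivAt (Ici_mem_nhds hs.1))
      ((hcont.mono Icc_subset_Ici_self).intervalIntegrable_of_Icc ht)
  refine ⟨δ⁻¹ * M + ‖δ⁻¹ • (ls - lam t₀) + β t₀ • (A (x t₀) - b)‖, fun t ht => ?_⟩
  have heq : β t • (A (x t) - b) + ∫ s in t₀..t, (β s / δ - β' s) • (A (x s) - b) =
      δ⁻¹ • (lam t - ls) + (δ⁻¹ • (ls - lam t₀) + β t₀ • (A (x t₀) - b)) := by
    rw [hint t ht]
    module
  rw [heq]
  refine (norm_add_le _ _).trans <| add_le_add_left ?_ _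
  rw [norm_smul, Real.norm_of_nonneg (inv_nonneg.mpr hδ.le)]
  exact mul_le_mul_of_nonneg_left (hM t ht) (inv_nonneg.mpr hδ.le)
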